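/- Let γ be a product probability density on ℝ^N and for each j let P_j denote integration of the j-th variable against its marginal. Then for any probability density h ≥ 0 with respect to γ with finite entropy, Σ_{j=1}^N S(P_j h) ≤ (N−1)·S(h), where S(u) = ∫ u log u γ dv. -/

import Mathlib

open MeasureTheory Real

section HanAux

open scoped ENNReal

variable {N : ℕ} {μ : Measure ℝ} [IsProbabilityMeasure μ]

theorem han_lmarginal_mul (s : Finset (Fin N)) {A B : (Fin N → ℝ) → ℝ≥0∞}
    (hA : Measurable A) (hB : ∀ x y, (∀ i ∉ s, x i = y i) → B x = B y) :
    (∫⋯∫⁻_s, (fun v => A v * B v) ∂(fun _ : Fin N => μ)) =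
      fun v => (∫⋯∫⁻_s, A ∂(fun _ : Fin N => μ)) v * B v := by
  ext v
  unfold lmarginal
  have : ∀ y : (i : s) → ℝ, B (Function.updateFinset v s y) = B v := by
    intro y
    apply hB
    intro i hi
    simp [Function.updateFinset, hi]
  simp_rw [this]
  rw [lintegral_mul_const]
  exact hA.comp measurable_updateFinset

theorem han_lmarginal_lmarginal (s : Finset (Fin N)) {A : (Fin N → ℝ) → ℝ≥0∞} :
    (∫⋯∫⁻_s, (∫⋯∫⁻_s, A ∂(fun _ : Fin N => μ)) ∂(fun _ : Fin N => μ)) =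
      (∫⋯∫⁻_s, A ∂(fun _ : Fin N => μ)) := by
  have h := han_lmarginal_mul (μ := μ) s (A := fun _ => 1)
    (B := ∫⋯∫⁻_s, A ∂(fun _ : Fin N => μ)) measurable_const
    (fun x y hxy => lmarginal_congr _ _ hxy)
  simp only [one_mul] at h
  ext v
  rw [h]
  simp [lmarginal]

/-- pulling out functions not depending on the coordinates in `s`. -/
theorem han_pull (s : Finset (Fin N)) {A B : (Fin N → ℝ) → ℝ≥0∞}
    (hA : Measurable A) (hBm : Measurable B) (hB : ∀ x y, (∀ i ∉ s, x i = y i) → B x = B y) :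
    ∫⁻ v, A v * B v ∂(Measure.pi fun _ : Fin N => μ) =
      ∫⁻ v, (∫⋯∫⁻_s, A ∂(fun _ : Fin N => μ)) v * B v ∂(Measure.pi fun _ : Fin N => μ) := by
  apply lintegral_eq_of_lmarginal_eq s (hA.mul hBm) ((hA.lmarginal _).mul hBm)
  change (∫⋯∫⁻_s, (fun v => A v * B v) ∂(fun _ : Fin N => μ)) =
    ∫⋯∫⁻_s, (fun v => (∫⋯∫⁻_s, A ∂(fun _ : Fin N => μ)) v * B v) ∂(fun _ : Fin N => μ)
  rw [han_lmarginal_mul s hA hB, han_lmarginal_mul s (hA.lmarginal _) hB, han_lmarginal_lmarginal]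

theorem han_lint (s : Finset (Fin N)) {A : (Fin N → ℝ) → ℝ≥0∞} (hA : Measurable A) :
    ∫⁻ v, (∫⋯∫⁻_s, A ∂(fun _ : Fin N => μ)) v ∂(Measure.pi fun _ : Fin N => μ) =
      ∫⁻ v, A v ∂(Measure.pi fun _ : Fin N => μ) := by
  have := han_pull (μ := μ) s hA (B := fun _ => 1) measurable_const (fun _ _ _ => rfl)
  simpa using this.symm

theorem han_pos (s : Finset (Fin N)) {A : (Fin N → ℝ) → ℝ≥0∞} (hA : Measurable A) :
    ∀ᵐ v ∂(Measure.pi fun _ : Fin N => μ),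
      (∫⋯∫⁻_s, A ∂(fun _ : Fin N => μ)) v = 0 → A v = 0 := by
  set P := ∫⋯∫⁻_s, A ∂(fun _ : Fin N => μ) with hP
  have hPm : Measurable P := hA.lmarginal _
  let B : (Fin N → ℝ) → ℝ≥0∞ := fun v => Set.indicator {0} (fun _ => 1) (P v)
  have hBm : Measurable B :=
    (measurable_const.indicator (measurableSet_singleton (0 : ℝ≥0∞))).comp hPm
  have h := han_pull (μ := μ) s hA hBm
    (fun x y hxy => by
      have e : P x = P y := lmarginal_congr _ _ hxy
      simp only [B, e])
  have h0 : ∀ v, P v * B v = 0 := by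
    intro v
    by_cases hv : P v = 0 <;> simp [B, hv]
  rw [← hP] at h
  simp only [h0, lintegral_zero] at h
  replace h := (lintegral_eq_zero_iff (hA.mul hBm)).1 h
  filter_upwards [h] with v hv hv0
  simpa [B, hv0] using hv

theorem han_integral (s : Finset (Fin N)) {A : (Fin N → ℝ) → ℝ≥0∞} (hA : Measurable A)
    (hA1 : ∫⁻ v, A v ∂(Measure.pi fun _ : Fin N => μ) ≠ ∞)
    {c : (Fin N → ℝ) → ℝ} (hc : Measurable c) (hB : ∀ x y, (∀ i ∉ s, x i = y i) → c x = c y)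
    (hi : Integrable (fun v => ((∫⋯∫⁻_s, A ∂(fun _ : Fin N => μ)) v).toReal * c v)
      (Measure.pi fun _ : Fin N => μ)) :
    Integrable (fun v => (A v).toReal * c v) (Measure.pi fun _ : Fin N => μ) ∧
    ∫ v, (A v).toReal * c v ∂(Measure.pi fun _ : Fin N => μ) =
      ∫ v, ((∫⋯∫⁻_s, A ∂(fun _ : Fin N => μ)) v).toReal * c v
        ∂(Measure.pi fun _ : Fin N => μ) := by
  set P := ∫⋯∫⁻_s, A ∂(fun _ : Fin N => μ) with hP
  have hPm : Measurable P := hA.lmarginal _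
  have hAf := ae_lt_top hA hA1
  have hPf := ae_lt_top hPm (by rw [han_lint s hA]; exact hA1)
  have key : ∀ (φ : ℝ → ℝ≥0∞), Measurable φ →
      ∫⁻ v, A v * φ (c v) ∂(Measure.pi fun _ : Fin N => μ) =
      ∫⁻ v, P v * φ (c v) ∂(Measure.pi fun _ : Fin N => μ) := fun φ hφ =>
    han_pull s hA (hφ.comp hc) (fun x y hxy => by rw [hB x y hxy])
  have e1 : ∀ (Q : (Fin N → ℝ) → ℝ≥0∞), (∀ᵐ v ∂(Measure.pi fun _ : Fin N => μ), Q v < ∞) →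
      ∫⁻ v, ‖(Q v).toReal * c v‖ₑ ∂(Measure.pi fun _ : Fin N => μ) =
      ∫⁻ v, Q v * ‖c v‖ₑ ∂(Measure.pi fun _ : Fin N => μ) := by
    intro Q hQ
    apply lintegral_congr_ae
    filter_upwards [hQ] with v hv
    rw [enorm_mul, Real.enorm_of_nonneg ENNReal.toReal_nonneg, ENNReal.ofReal_toReal hv.ne]
  have e2 : ∀ (Q : (Fin N → ℝ) → ℝ≥0∞), (∀ᵐ v ∂(Measure.pi fun _ : Fin N => μ), Q v < ∞) →
      ∫⁻ v, ENNReal.ofReal ((Q v).toReal * c v) ∂(Measure.pi fun _ : Fin N => μ) =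
      ∫⁻ v, Q v * ENNReal.ofReal (c v) ∂(Measure.pi fun _ : Fin N => μ) := by
    intro Q hQ
    apply lintegral_congr_ae
    filter_upwards [hQ] with v hv
    rw [ENNReal.ofReal_mul ENNReal.toReal_nonneg, ENNReal.ofReal_toReal hv.ne]
  have e3 : ∀ (Q : (Fin N → ℝ) → ℝ≥0∞), (∀ᵐ v ∂(Measure.pi fun _ : Fin N => μ), Q v < ∞) →
      ∫⁻ v, ENNReal.ofReal (-((Q v).toReal * c v)) ∂(Measure.pi fun _ : Fin N => μ) =
      ∫⁻ v, Q v * ENNReal.ofReal (-c v) ∂(Measure.pi fun _ : Fin N => μ) := by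
    intro Q hQ
    apply lintegral_congr_ae
    filter_upwards [hQ] with v hv
    rw [← mul_neg, ENNReal.ofReal_mul ENNReal.toReal_nonneg, ENNReal.ofReal_toReal hv.ne]
  have hI : Integrable (fun v => (A v).toReal * c v) (Measure.pi fun _ : Fin N => μ) := by
    refine ⟨(hA.ennreal_toReal.mul hc).aestronglyMeasurable, ?_⟩
    have := hi.2
    unfold HasFiniteIntegral at this ⊢
    rw [e1 _ hPf] at this
    rw [e1 _ hAf, key (fun x => ‖x‖ₑ) measurable_enorm]
    exact this
  refine ⟨hI, ?_⟩
  rw [integral_eq_lintegral_pos_part_sub_lintegral_neg_part hI,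
    integral_eq_lintegral_pos_part_sub_lintegral_neg_part hi, e2 _ hAf, e2 _ hPf, e3 _ hAf,
    e3 _ hPf, key ENNReal.ofReal ENNReal.measurable_ofReal,
    key (fun x => ENNReal.ofReal (-x)) (by fun_prop)]

/-- pointwise inequality -/
theorem han_pointwise (n : ℕ) (a : ℝ) (b : Fin n → ℝ) (f : ℕ → ℝ) (ha : 0 ≤ a)
    (hf0 : f 0 = a) (hfn : f n = 1) (hb0 : ∀ j, 0 ≤ b j) (hfnn : ∀ k, 0 ≤ f k)
    (hb : a ≠ 0 → ∀ j, b j ≠ 0) (hf : a ≠ 0 → ∀ k, f k ≠ 0) :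
    (n : ℝ) * a - ∑ j : Fin n, b j * (f j / f (j + 1)) ≤
      (n - 1 : ℝ) * (a * log a) - ∑ j : Fin n, a * log (b j) := by
  by_cases h0 : a = 0
  · subst h0
    simp only [mul_zero, zero_mul, Finset.sum_const_zero, sub_zero, zero_sub, log_zero]
    rw [neg_nonpos]
    exact Finset.sum_nonneg fun j _ => mul_nonneg (hb0 j) (div_nonneg (hfnn _) (hfnn _))
  have hap : 0 < a := lt_of_le_of_ne ha (Ne.symm h0)
  have hbp : ∀ j, 0 < b j := fun j => lt_of_le_of_ne (hb0 j) (Ne.symm (hb h0 j))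
  have hfp : ∀ k, 0 < f k := fun k => lt_of_le_of_ne (hfnn k) (Ne.symm (hf h0 k))
  have tel : ∑ j : Fin n, (log (f j) - log (f (j + 1))) = log a := by
    rw [Fin.sum_univ_eq_sum_range (fun j => log (f j) - log (f (j + 1))) n,
      Finset.sum_range_sub', hf0, hfn]
    simp
  have step : ∀ j : Fin n, a - b j * (f j / f (j + 1)) ≤
      a * log a - a * log (b j) - a * (log (f j) - log (f (j + 1))) := by
    intro j
    have hT : 0 < b j * (f j / f (j + 1)) := mul_pos (hbp j) (div_pos (hfp _) (hfp _))
    have h1 := Real.log_le_sub_one_of_pos (div_pos hT hap)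
    rw [log_div hT.ne' hap.ne', log_mul (hbp j).ne' (div_pos (hfp _) (hfp _)).ne',
      log_div (hfp _).ne' (hfp _).ne'] at h1
    have h2 := mul_le_mul_of_nonneg_left h1 ha
    have h3 : a * (b j * (f j / f (j + 1)) / a - 1) = b j * (f j / f (j + 1)) - a := by
      field_simp
    rw [h3] at h2
    linarith
  have := Finset.sum_le_sum fun j (_ : j ∈ Finset.univ) => step j
  rw [Finset.sum_sub_distrib, Finset.sum_sub_distrib, Finset.sum_sub_distrib, ← Finset.mul_sum,
    ← Finset.mul_sum, ← Finset.mul_sum, tel] at this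
  simp only [Finset.sum_const, Finset.card_univ, Fintype.card_fin, nsmul_eq_mul] at this
  rw [← Finset.mul_sum]
  linarith

/-- Abstract form. -/
theorem han_core {F : (Fin N → ℝ) → ℝ≥0∞} (hF : Measurable F)
    (hF1 : ∫⁻ v, F v ∂(Measure.pi fun _ : Fin N => μ) = 1)
    (hint : Integrable (fun v => (F v).toReal * log (F v).toReal)
      (Measure.pi fun _ : Fin N => μ))
    (hintj : ∀ j : Fin N, Integrable
      (fun v => ((∫⋯∫⁻_{j}, F ∂(fun _ : Fin N => μ)) v).toReal *
        log ((∫⋯∫⁻_{j}, F ∂(fun _ : Fin N => μ)) v).toReal) (Measure.pi fun _ : Fin N => μ)) :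
    ∑ j : Fin N, ∫ v, ((∫⋯∫⁻_{j}, F ∂(fun _ : Fin N => μ)) v).toReal *
        log ((∫⋯∫⁻_{j}, F ∂(fun _ : Fin N => μ)) v).toReal ∂(Measure.pi fun _ : Fin N => μ)
      ≤ (N - 1 : ℝ) * ∫ v, (F v).toReal * log (F v).toReal ∂(Measure.pi fun _ : Fin N => μ) := by
  set ρ := Measure.pi fun _ : Fin N => μ with hρ
  let s : ℕ → Finset (Fin N) := fun k => Finset.univ.filter (fun i => (i : ℕ) < k)
  let f : ℕ → (Fin N → ℝ) → ℝ≥0∞ := fun k => ∫⋯∫⁻_(s k), F ∂(fun _ : Fin N => μ)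
  let b : Fin N → (Fin N → ℝ) → ℝ≥0∞ := fun j => ∫⋯∫⁻_{j}, F ∂(fun _ : Fin N => μ)
  have hfm : ∀ k, Measurable (f k) := fun k => hF.lmarginal _
  have hbm : ∀ j, Measurable (b j) := fun k => hF.lmarginal _
  have hf0 : f 0 = F := by simp [f, s]
  have hfN : f N = fun _ => 1 := by
    have : s N = Finset.univ := by ext i; simp [s]
    simp only [f, this, lmarginal_univ]
    rw [← hρ, hF1]
  have hfi : ∀ k, ∫⁻ v, f k v ∂ρ = 1 := fun k => by rw [← hF1]; exact han_lint _ hF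
  have hbi : ∀ j, ∫⁻ v, b j v ∂ρ = 1 := fun k => by rw [← hF1]; exact han_lint _ hF
  let T : Fin N → (Fin N → ℝ) → ℝ≥0∞ := fun j v => b j v * (f j v / f (j + 1) v)
  have hTm : ∀ j, Measurable (T j) := fun j => (hbm j).mul ((hfm _).div (hfm _))
  have hTi : ∀ j, ∫⁻ v, T j v ∂ρ ≤ 1 := by
    intro j
    have h1 : ∫⋯∫⁻_(s j), b j ∂(fun _ : Fin N => μ) = f (j + 1) := by
      have hs : s (j + 1) = s j ∪ {j} := by
        ext i; simp [s, Fin.ext_iff]; omega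
      simp only [f, b, hs]
      rw [lmarginal_union _ _ hF]
      simp [s]
    have h2 := han_pull (μ := μ) (s j) (hbm j) (B := fun v => f j v / f (j + 1) v)
      ((hfm _).div (hfm _)) (by
        intro x y hxy
        have e1 : f j x = f j y := lmarginal_congr _ _ hxy
        have e2 : f (j + 1) x = f (j + 1) y := lmarginal_congr _ _ (fun i hi => hxy i (by
          simp [s] at hi ⊢; omega))
        simp only [e1, e2])
    rw [h1] at h2
    simp only [T]
    rw [hρ, h2, ← hρ, ← hfi j]
    exact lintegral_mono fun v => ENNReal.mul_div_le
  have hFt := ae_lt_top hF (μ := ρ) (by rw [hF1]; simp)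
  have hft : ∀ᵐ v ∂ρ, ∀ k, f k v < ∞ :=
    ae_all_iff.2 fun k => ae_lt_top (hfm k) (by rw [hfi]; simp)
  have hbt : ∀ᵐ v ∂ρ, ∀ k, b k v < ∞ :=
    ae_all_iff.2 fun k => ae_lt_top (hbm k) (by rw [hbi]; simp)
  have hfz : ∀ᵐ v ∂ρ, ∀ k, f k v = 0 → F v = 0 := ae_all_iff.2 fun k => han_pos _ hF
  have hbz : ∀ᵐ v ∂ρ, ∀ k, b k v = 0 → F v = 0 := ae_all_iff.2 fun k => han_pos _ hF
  have hpt : ∀ᵐ v ∂ρ, (N : ℝ) * (F v).toReal - ∑ j, (T j v).toReal ≤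
      (N - 1 : ℝ) * ((F v).toReal * log (F v).toReal) -
        ∑ j, (F v).toReal * log (b j v).toReal := by
    filter_upwards [hFt, hft, hbt, hfz, hbz] with v h1 h2 h3 h4 h5
    have := han_pointwise N (F v).toReal (fun j => (b j v).toReal) (fun k => (f k v).toReal)
      ENNReal.toReal_nonneg (by simp [hf0]) (by simp [hfN]) (fun _ => ENNReal.toReal_nonneg)
      (fun _ => ENNReal.toReal_nonneg)
      (fun ha j hb => ha (by
        rcases (ENNReal.toReal_eq_zero_iff _).1 hb with h | h
        · simp [h5 j h]
        · exact absurd h (h3 j).ne))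
      (fun ha j hb => ha (by
        rcases (ENNReal.toReal_eq_zero_iff _).1 hb with h | h
        · simp [h4 j h]
        · exact absurd h (h2 j).ne))
    simpa [T, ENNReal.toReal_mul, ENNReal.toReal_div] using this
  have hcj : ∀ j, Integrable (fun v => (F v).toReal * log (b j v).toReal) ρ ∧
      ∫ v, (F v).toReal * log (b j v).toReal ∂ρ =
        ∫ v, (b j v).toReal * log (b j v).toReal ∂ρ := fun j =>
    han_integral {j} hF (by rw [← hρ, hF1]; simp) (c := fun v => log (b j v).toReal)
      (Real.measurable_log.comp (hbm j).ennreal_toReal)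
      (fun x y hxy => by
        have : b j x = b j y := lmarginal_congr _ _ hxy
        simp only [this]) (hintj j)
  have hFint : Integrable (fun v => (F v).toReal) ρ :=
    integrable_toReal_of_lintegral_ne_top hF.aemeasurable (by rw [hF1]; simp)
  have hTint : ∀ j, Integrable (fun v => (T j v).toReal) ρ := fun j =>
    integrable_toReal_of_lintegral_ne_top (hTm j).aemeasurable
      (ne_top_of_le_ne_top ENNReal.one_ne_top (hTi j))
  have hF2 : ∫ v, (F v).toReal ∂ρ = 1 := by
    rw [integral_toReal hF.aemeasurable hFt, hF1]; simp
  have hT2 : ∀ j, ∫ v, (T j v).toReal ∂ρ ≤ 1 := by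
    intro j
    rw [integral_toReal (hTm j).aemeasurable
      (ae_lt_top (hTm j) (ne_top_of_le_ne_top ENNReal.one_ne_top (hTi j)))]
    exact ENNReal.toReal_le_of_le_ofReal zero_le_one (by simpa using hTi j)
  have hfin := integral_mono_ae
    ((hFint.const_mul (N : ℝ)).sub (integrable_finsetSum Finset.univ fun j _ => hTint j))
    ((hint.const_mul (N - 1 : ℝ)).sub (integrable_finsetSum Finset.univ fun j _ => (hcj j).1))
    hpt
  simp only [Pi.sub_apply] at hfin
  rw [integral_sub (hFint.const_mul (N : ℝ)) (integrable_finsetSum Finset.univ fun j _ => hTint j),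
    integral_sub (hint.const_mul (N - 1 : ℝ))
      (integrable_finsetSum Finset.univ fun j _ => (hcj j).1),
    integral_const_mul, integral_const_mul, integral_finsetSum _ fun j _ => hTint j,
    integral_finsetSum _ fun j _ => (hcj j).1, hF2] at hfin
  have hs : ∑ j, ∫ v, (T j v).toReal ∂ρ ≤ N := by
    calc _ ≤ ∑ j : Fin N, (1 : ℝ) := Finset.sum_le_sum fun j _ => hT2 j
      _ = N := by simp
  have hs2 : ∑ j, ∫ v, (F v).toReal * log (b j v).toReal ∂ρ =
      ∑ j, ∫ v, (b j v).toReal * log (b j v).toReal ∂ρ :=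
    Finset.sum_congr rfl fun j _ => (hcj j).2
  rw [hs2] at hfin
  change ∑ j, ∫ v, (b j v).toReal * log (b j v).toReal ∂ρ ≤ _
  linarith

theorem han_pi_withDensity (g : ℝ → ℝ) (hg0 : ∀ v, 0 ≤ g v) (hg : Integrable g)
    [IsProbabilityMeasure (volume.withDensity fun x => ENNReal.ofReal (g x))] :
    Measure.pi (fun _ : Fin N => volume.withDensity fun x => ENNReal.ofReal (g x)) =
      (volume : Measure (Fin N → ℝ)).withDensity fun v => ENNReal.ofReal (∏ i, g (v i)) := by
  apply Measure.pi_eq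
  intro t ht
  have hI : Integrable (fun v : Fin N → ℝ => ∏ i, g (v i)) :=
    Integrable.fintype_prod (f := fun _ => g) (fun _ => hg)
  rw [withDensity_apply _ (MeasurableSet.univ_pi ht),
    ← ofReal_integral_eq_lintegral_ofReal hI.integrableOn
      (ae_of_all _ fun v => Finset.prod_nonneg fun i _ => hg0 _),
    volume_pi, Measure.restrict_pi_pi, integral_fintype_prod_eq_prod (fun _ => g),
    ENNReal.ofReal_prod_of_nonneg
      (fun i _ => integral_nonneg fun v => hg0 v)]
  refine Finset.prod_congr rfl fun i _ => ?_
  rw [withDensity_apply _ (ht i), ← ofReal_integral_eq_lintegral_ofReal hg.integrableOn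
      (ae_of_all _ hg0)]

end HanAux

/-- continuous Han inequality: For the product probability density
γ(v) = Π_j g(v_j) on ℝ^N and a probability density h w.r.t. γ with finite entropy,
Σ_j S(P_j h) ≤ (N−1)·S(h), where P_j h integrates out the j-th variable against g
and S(u) = ∫ u log u γ dv. -/
theorem han_inequality (N : ℕ) (g : ℝ → ℝ) (hg0 : ∀ v, 0 ≤ g v)
    (hg1 : ∫ v : ℝ, g v = 1)
    (h : (Fin N → ℝ) → ℝ) (hh0 : ∀ v, 0 ≤ h v)
    (hnorm : ∫ v : Fin N → ℝ, h v * ∏ j, g (v j) = 1)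
    (hint : Integrable (fun v : Fin N → ℝ => h v * Real.log (h v) * ∏ j, g (v j)))
    (hintj : ∀ j : Fin N, Integrable (fun v : Fin N → ℝ =>
      (∫ w : ℝ, h (Function.update v j w) * g w) *
        Real.log (∫ w : ℝ, h (Function.update v j w) * g w) * ∏ i, g (v i))) :
    ∑ j : Fin N, ∫ v : Fin N → ℝ,
        (∫ w : ℝ, h (Function.update v j w) * g w) *
          Real.log (∫ w : ℝ, h (Function.update v j w) * g w) * ∏ i, g (v i)
      ≤ (N - 1 : ℝ) * ∫ v : Fin N → ℝ, h v * Real.log (h v) * ∏ j, g (v j) := by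
  have hg : Integrable g := by
    by_contra hc
    rw [integral_undef hc] at hg1
    exact zero_ne_one hg1
  have hγ0 : ∀ v : Fin N → ℝ, 0 ≤ ∏ i, g (v i) := fun v => Finset.prod_nonneg fun i _ => hg0 _
  have hγ : Integrable (fun v : Fin N → ℝ => ∏ i, g (v i)) :=
    Integrable.fintype_prod (f := fun _ => g) (fun _ => hg)
  let μ : Measure ℝ := volume.withDensity fun x => ENNReal.ofReal (g x)
  have hμ : IsProbabilityMeasure μ := ⟨by
    simp only [μ]
    rw [withDensity_apply _ MeasurableSet.univ, Measure.restrict_univ,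
      ← ofReal_integral_eq_lintegral_ofReal hg (ae_of_all _ hg0), hg1, ENNReal.ofReal_one]⟩
  let ρ : Measure (Fin N → ℝ) := Measure.pi fun _ : Fin N => μ
  have hρ : ρ = (volume : Measure (Fin N → ℝ)).withDensity
      fun v => ENNReal.ofReal (∏ i, g (v i)) := han_pi_withDensity g hg0 hg
  have cI : ∀ u : (Fin N → ℝ) → ℝ, Integrable u ρ ↔
      Integrable (fun v : Fin N → ℝ => u v * ∏ i, g (v i)) := by
    intro u
    rw [hρ, integrable_withDensity_iff_integrable_smul₀' hγ.1.aemeasurable.ennreal_ofReal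
      (ae_of_all _ fun _ => ENNReal.ofReal_lt_top)]
    simp_rw [ENNReal.toReal_ofReal (hγ0 _), smul_eq_mul, mul_comm]
  have cE : ∀ u : (Fin N → ℝ) → ℝ, ∫ v, u v ∂ρ = ∫ v : Fin N → ℝ, u v * ∏ i, g (v i) := by
    intro u
    rw [hρ, integral_withDensity_eq_integral_toReal_smul₀ hγ.1.aemeasurable.ennreal_ofReal
      (ae_of_all _ fun _ => ENNReal.ofReal_lt_top)]
    simp_rw [ENNReal.toReal_ofReal (hγ0 _), smul_eq_mul, mul_comm]
  have c1 : ∀ u : ℝ → ℝ, ∫ w, u w * g w = ∫ w, u w ∂μ := by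
    intro u
    simp only [μ]
    rw [integral_withDensity_eq_integral_toReal_smul₀ hg.1.aemeasurable.ennreal_ofReal
      (ae_of_all _ fun _ => ENNReal.ofReal_lt_top)]
    simp_rw [ENNReal.toReal_ofReal (hg0 _), smul_eq_mul, mul_comm]
  have hhI : Integrable h ρ := by
    rw [cI]
    by_contra hc
    rw [integral_undef hc] at hnorm
    exact zero_ne_one hnorm
  have hE := hhI.1.aemeasurable.ennreal_ofReal
  let F := hE.mk _
  have hF : Measurable F := hE.measurable_mk
  have hFe : ∀ᵐ v ∂ρ, ENNReal.ofReal (h v) = F v := hE.ae_eq_mk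
  have hFr : ∀ᵐ v ∂ρ, h v = (F v).toReal := by
    filter_upwards [hFe] with v hv
    rw [← hv, ENNReal.toReal_ofReal (hh0 v)]
  have hF1 : ∫⁻ v, F v ∂ρ = 1 := by
    rw [← lintegral_congr_ae hFe, ← ofReal_integral_eq_lintegral_ofReal hhI (ae_of_all _ hh0),
      cE, hnorm, ENNReal.ofReal_one]
  have hslice : ∀ j : Fin N, ∀ᵐ v ∂ρ, ∀ᵐ w ∂μ,
      ENNReal.ofReal (h (Function.update v j w)) = F (Function.update v j w) := by
    intro j
    obtain ⟨Z, hZs, hZm, hZ0⟩ := exists_measurable_superset_of_null (ae_iff.1 hFe)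
    have h1 := han_lint (μ := μ) {j} (A := Z.indicator fun _ => 1)
      (measurable_const.indicator hZm)
    change ∫⁻ v, _ ∂ρ = ∫⁻ v, _ ∂ρ at h1
    rw [lintegral_indicator_const hZm, hZ0, mul_zero,
      lintegral_eq_zero_iff ((measurable_const.indicator hZm).lmarginal _)] at h1
    filter_upwards [h1] with v hv
    rw [lmarginal_singleton] at hv
    have hm : Measurable fun w : ℝ => Z.indicator (fun _ => (1 : ENNReal)) (Function.update v j w) :=
      (measurable_const.indicator hZm).comp (measurable_update v)
    have hv' := (lintegral_eq_zero_iff hm).1 hv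
    filter_upwards [hv'] with w hw
    by_contra hne
    have : Function.update v j w ∈ Z := hZs hne
    simp [this] at hw
  have hPj : ∀ j : Fin N, ∀ᵐ v ∂ρ, ∫ w : ℝ, h (Function.update v j w) * g w =
      ((∫⋯∫⁻_{j}, F ∂(fun _ : Fin N => μ)) v).toReal := by
    intro j
    filter_upwards [hslice j] with v hv
    have hm : Measurable fun w : ℝ => F (Function.update v j w) := hF.comp (measurable_update v)
    have he : ∀ᵐ w ∂μ, h (Function.update v j w) = (F (Function.update v j w)).toReal := by
      filter_upwards [hv] with w hw
      rw [← hw, ENNReal.toReal_ofReal (hh0 _)]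
    rw [c1 (fun w => h (Function.update v j w)), integral_congr_ae he, lmarginal_singleton,
      integral_toReal hm.aemeasurable]
    filter_upwards [hv] with w hw
    rw [← hw]
    exact ENNReal.ofReal_lt_top
  have q0 : (fun v => h v * Real.log (h v)) =ᵐ[ρ]
      fun v => (F v).toReal * log (F v).toReal := by
    filter_upwards [hFr] with v hv
    rw [hv]
  have qj : ∀ j : Fin N, (fun v => (∫ w : ℝ, h (Function.update v j w) * g w) *
        Real.log (∫ w : ℝ, h (Function.update v j w) * g w)) =ᵐ[ρ]
      fun v => ((∫⋯∫⁻_{j}, F ∂(fun _ : Fin N => μ)) v).toReal *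
        log ((∫⋯∫⁻_{j}, F ∂(fun _ : Fin N => μ)) v).toReal := by
    intro j
    filter_upwards [hPj j] with v hv
    rw [hv]
  have hmain := han_core (μ := μ) hF hF1
    (((cI fun v => h v * Real.log (h v)).2 hint).congr q0)
    (fun j => ((cI fun v => (∫ w : ℝ, h (Function.update v j w) * g w) *
        Real.log (∫ w : ℝ, h (Function.update v j w) * g w)).2 (hintj j)).congr (qj j))
  rw [← cE fun v => h v * Real.log (h v), integral_congr_ae q0]
  refine le_trans (le_of_eq ?_) hmain
  refine Finset.sum_congr rfl fun j _ => ?_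
  rw [← cE fun v => (∫ w : ℝ, h (Function.update v j w) * g w) *
        Real.log (∫ w : ℝ, h (Function.update v j w) * g w), integral_congr_ae (qj j)]
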